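/- Let A and B be C*-algebras with A unital, let p be a projection in A, and let T : A → B be a linear map which is a *-homomorphism at p and a *-homomorphism at 1 − p. Then T is a Jordan *-homomorphism, that is, T(a*) = T(a)* and T(a²) = T(a)² for every a ∈ A. -/

import Mathlib

/-- A map `T` between C*-algebras is a `*`-homomorphism at the point `z` if
`a * b* = z` implies `T (a * b*) = T a * (T b)* = T z` and
`c* * d = z` implies `T (c* * d) = (T c)* * T d = T z`. -/
def IsStarHomAt {A B : Type*} [Mul A] [Star A] [Mul B] [Star B]
    (T : A → B) (z : A) : Prop :=
  (∀ a b : A, a * star b = z →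
      T (a * star b) = T a * star (T b) ∧ T a * star (T b) = T z) ∧
  (∀ c d : A, star c * d = z →
      T (star c * d) = star (T c) * T d ∧ star (T c) * T d = T z)

namespace IsStarHomAt

section Ring

variable {A B : Type*} [Ring A] [StarRing A] [NonUnitalRing B] [StarRing B]

/-- Being a `*`-homomorphism at two complementary elements forces it at the unit. -/
theorem one_of_compl [Module ℂ A] [Module ℂ B] {T : A →ₗ[ℂ] B} {p : A}
    (h1 : IsStarHomAt (⇑T) p) (h2 : IsStarHomAt (⇑T) (1 - p)) :
    IsStarHomAt (⇑T) 1 := by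
  constructor
  · intro a b hab
    have e1 := (h1.1 (p * a) b (by rw [mul_assoc, hab, mul_one])).2
    have e2 := (h2.1 ((1 - p) * a) b (by rw [mul_assoc, hab, mul_one])).2
    have e : T a * star (T b) = T 1 := by
      rw [show a = p * a + (1 - p) * a by noncomm_ring, map_add, add_mul, e1, e2, ← map_add,
        add_sub_cancel]
    exact ⟨by rw [hab, e], e⟩
  · intro c d hcd
    have e1 := (h1.2 c (d * p) (by rw [← mul_assoc, hcd, one_mul])).2
    have e2 := (h2.2 c (d * (1 - p)) (by rw [← mul_assoc, hcd, one_mul])).2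
    have e : star (T c) * T d = T 1 := by
      rw [show d = d * p + d * (1 - p) by noncomm_ring, map_add, mul_add, e1, e2, ← map_add,
        add_sub_cancel]
    exact ⟨by rw [hcd, e], e⟩

variable {T : A → B}

theorem mul_star_map_star (h : IsStarHomAt T 1) {x y : A} (hxy : x * y = 1) :
    T x * star (T (star y)) = T 1 :=
  (h.1 x (star y) (by rwa [star_star])).2

theorem star_map_star_mul (h : IsStarHomAt T 1) {x y : A} (hxy : x * y = 1) :
    star (T (star x)) * T y = T 1 :=
  (h.2 (star x) y (by rwa [star_star])).2

theorem star_map_one (h : IsStarHomAt T 1) : star (T 1) = T 1 := by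
  have e := (h.1 1 1 (by simp)).2
  rw [← e, star_mul, star_star]

theorem map_one_mul_map_one (h : IsStarHomAt T 1) : T 1 * T 1 = T 1 := by
  simpa only [h.star_map_one] using (h.1 1 1 (by simp)).2

end Ring

section CStarAlgebra

variable {A B : Type*} [CStarAlgebra A] [NonUnitalCStarAlgebra B] {T : A →ₗ[ℂ] B}

theorem map_one_mul (h : IsStarHomAt (⇑T) 1) (a : A) : T 1 * T a = T a := by
  have ha : a ∈ Submodule.span ℂ (unitary A : Set A) := by
    rw [CStarAlgebra.span_unitary]; trivial
  induction ha using Submodule.span_induction with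
  | mem u hu =>
    have e := (h.1 u u (Unitary.mul_star_self_of_mem hu)).2
    rw [← sub_eq_zero, ← CStarRing.mul_star_self_eq_zero_iff]
    simp only [star_sub, star_mul, h.star_map_one, sub_mul, mul_sub]
    have e' : T u * (star (T u) * T 1) = T 1 := by
      rw [← mul_assoc, e, h.map_one_mul_map_one]
    simp only [mul_assoc, e, e', h.map_one_mul_map_one, sub_self]
  | zero => simp
  | add x y _ _ hx hy => rw [map_add, mul_add, hx, hy]
  | smul c x _ hx => rw [map_smul, mul_smul_comm, hx]

theorem mul_map_one (h : IsStarHomAt (⇑T) 1) (a : A) : T a * T 1 = T a := by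
  have ha : a ∈ Submodule.span ℂ (unitary A : Set A) := by
    rw [CStarAlgebra.span_unitary]; trivial
  induction ha using Submodule.span_induction with
  | mem u hu =>
    have e := (h.2 u u (Unitary.star_mul_self_of_mem hu)).2
    rw [← sub_eq_zero, ← CStarRing.star_mul_self_eq_zero_iff]
    simp only [star_sub, star_mul, h.star_map_one, sub_mul, mul_sub]
    have e' : star (T u) * (T u * T 1) = T 1 := by
      rw [← mul_assoc, e, h.map_one_mul_map_one]
    simp only [mul_assoc, e, e', h.map_one_mul_map_one, sub_self]
  | zero => simp
  | add x y _ _ hx hy => rw [map_add, add_mul, hx, hy]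
  | smul c x _ hx => rw [map_smul, smul_mul_assoc, hx]

/-- The identity `a⁻¹ + (1 - a)⁻¹ = (a - a²)⁻¹` gives multiplicativity on squares. -/
theorem map_mul_self_of_isUnit (h : IsStarHomAt (⇑T) 1) {a : A}
    (ha : IsUnit a) (ha' : IsUnit (1 - a)) : T (a * a) = T a * T a := by
  obtain ⟨b, hab, hba⟩ := isUnit_iff_exists.1 ha
  obtain ⟨d, had, hda⟩ := isUnit_iff_exists.1 ha'
  have hY := h.star_map_star_mul hba
  have hZ := h.star_map_star_mul hda
  have hV : T (a - a * a) * star (T (star (b + d))) = T 1 := by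
    refine h.mul_star_map_star ?_
    calc (a - a * a) * (b + d) = (1 - a) * (a * b) + a * ((1 - a) * d) := by noncomm_ring
      _ = 1 := by rw [hab, had]; noncomm_ring
  have hW : star (T (star (b + d))) * (T a - T a * T a) = T 1 := by
    rw [map_sub, mul_sub, sub_eq_iff_eq_add] at hZ
    rw [star_add, map_add, star_add]
    generalize star (T (star b)) = Y at *
    generalize star (T (star d)) = Z at *
    have hZX : Z * T a = Z * T 1 - T 1 := by rw [hZ]; abel
    have hZXX : Z * (T a * T a) = Z * T a - T a := by
      rw [← mul_assoc, hZX, sub_mul, mul_assoc, h.map_one_mul, hZX]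
    have hYXX : Y * (T a * T a) = T a := by rw [← mul_assoc, hY, h.map_one_mul]
    rw [add_mul, mul_sub, mul_sub, hY, hYXX, hZXX]
    abel
  have key : T (a - a * a) = T a - T a * T a := by
    calc T (a - a * a) = T (a - a * a) * T 1 := (h.mul_map_one _).symm
      _ = T 1 * (T a - T a * T a) := by rw [← hW, ← mul_assoc, hV, hW]
      _ = T a - T a * T a := by rw [mul_sub, ← mul_assoc, h.map_one_mul]
  rw [map_sub] at key
  exact sub_right_injective key

theorem map_mul_self (h : IsStarHomAt (⇑T) 1) (a : A) : T (a * a) = T a * T a := by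
  have hunit : ∀ k : ℂ, ‖a‖ * ‖(1 : A)‖ < ‖k‖ → IsUnit (k • (1 : A) - a) := fun k hk => by
    have := spectrum.mem_resolventSet_of_norm_lt_mul hk
    rwa [spectrum.mem_resolventSet_iff, Algebra.algebraMap_eq_smul_one] at this
  set r : ℝ := ‖a‖ * ‖(1 : A)‖ + 2 with hr
  have hr0 : 0 ≤ ‖a‖ * ‖(1 : A)‖ := by positivity
  have hk1 : ‖a‖ * ‖(1 : A)‖ < ‖(r : ℂ)‖ := by
    rw [Complex.norm_real, Real.norm_of_nonneg (by linarith)]; linarith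
  have hk2 : ‖a‖ * ‖(1 : A)‖ < ‖((r - 1 : ℝ) : ℂ)‖ := by
    rw [Complex.norm_real, Real.norm_of_nonneg (by linarith)]; linarith
  have u1 := hunit _ hk1
  have u2 : IsUnit (1 - ((r : ℂ) • (1 : A) - a)) := by
    convert (hunit _ hk2).neg using 1
    rw [Complex.ofReal_sub, Complex.ofReal_one, sub_smul, one_smul]
    abel
  have e := h.map_mul_self_of_isUnit u1 u2
  simp only [sub_mul, mul_sub, map_sub, map_smul, smul_mul_assoc, mul_smul_comm, one_mul, mul_one,
    h.map_one_mul, h.mul_map_one] at e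
  simpa using e

theorem map_mul_add_mul (h : IsStarHomAt (⇑T) 1) (a b : A) :
    T (a * b + b * a) = T a * T b + T b * T a := by
  have e := h.map_mul_self (a + b)
  simp only [add_mul, mul_add, map_add, h.map_mul_self] at e ⊢
  rw [← sub_eq_zero] at e ⊢
  rw [← e]
  abel

theorem map_eq_star_map_star_of_isUnit (h : IsStarHomAt (⇑T) 1) {b : A} (hb : IsUnit b) :
    T b = star (T (star b)) := by
  obtain ⟨a, hba, hab⟩ := isUnit_iff_exists.1 hb
  have hXY := h.mul_star_map_star hab
  have hYX := h.star_map_star_mul hba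
  have h1 : T a * T b + T b * T a = T 1 + T 1 := by
    rw [← h.map_mul_add_mul, hab, hba, map_add]
  have h2 : T a * T a * T b + T b * (T a * T a) = T a + T a := by
    rw [← h.map_mul_self, ← h.map_mul_add_mul, mul_assoc, hab, ← mul_assoc, hba, mul_one, one_mul,
      map_add]
  have h3 : T a * T a * T b + T a * T b * T a = T a + T a := by
    have := congrArg (T a * ·) h1
    simpa only [mul_add, h.mul_map_one, ← mul_assoc] using this
  have h4 : T a * T b * T a + T b * (T a * T a) = T a + T a := by
    have := congrArg (· * T a) h1
    simpa only [add_mul, h.map_one_mul, mul_assoc] using this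
  have h5 : T a * T b * T a = T a := by
    have e : (2 : ℂ) • (T a * T b * T a) = (2 : ℂ) • T a := by
      rw [two_smul, two_smul, ← add_right_inj (T a * T a * T b + T b * (T a * T a)), ← h4]
      nth_rw 2 [h2]
      rw [← h3]
      abel
    exact smul_right_injective B two_ne_zero e
  calc T b = T 1 * T b * T 1 := by rw [h.map_one_mul, h.mul_map_one]
    _ = star (T (star b)) * (T a * T b * T a) * star (T (star b)) := by
      simp only [← mul_assoc, hYX]
      simp only [mul_assoc, hXY]
    _ = star (T (star b)) := by
      rw [h5, hYX, ← h.star_map_one, ← star_mul, h.mul_map_one]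

theorem map_star (h : IsStarHomAt (⇑T) 1) (a : A) : T (star a) = star (T a) := by
  obtain ⟨k, hk⟩ : ∃ k : ℂ, IsUnit (k • (1 : A) - a) := by
    refine ⟨((‖a‖ * ‖(1 : A)‖ + 1 : ℝ) : ℂ), ?_⟩
    rw [← Algebra.algebraMap_eq_smul_one, ← spectrum.mem_resolventSet_iff]
    apply spectrum.mem_resolventSet_of_norm_lt_mul
    rw [Complex.norm_real, Real.norm_of_nonneg (by positivity)]
    linarith
  have e := h.map_eq_star_map_star_of_isUnit hk
  simp only [star_sub, star_smul, star_one, map_sub, map_smul, star_star, h.star_map_one,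
    sub_right_inj] at e
  rw [e, star_star]

end CStarAlgebra

end IsStarHomAt

theorem stmt9 {A B : Type*}
    [NormedRing A] [StarRing A] [CStarRing A] [CompleteSpace A]
    [NormedAlgebra ℂ A] [StarModule ℂ A]
    [NonUnitalNormedRing B] [StarRing B] [CStarRing B] [CompleteSpace B]
    [NormedSpace ℂ B] [IsScalarTower ℂ B B] [SMulCommClass ℂ B B] [StarModule ℂ B]
    (p : A) (hp_star : star p = p) (hp_idem : p * p = p)
    (T : A →ₗ[ℂ] B)
    (h1 : IsStarHomAt (⇑T) p) (h2 : IsStarHomAt (⇑T) (1 - p)) :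
    (∀ a : A, T (star a) = star (T a)) ∧ (∀ a : A, T (a * a) = T a * T a) := by
  let _ : CStarAlgebra A := {}
  let _ : NonUnitalCStarAlgebra B := {}
  have h := h1.one_of_compl h2
  exact ⟨h.map_star, h.map_mul_self⟩
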